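/- Let m, h, d, n, q, p ∈ ℕ, let H be an n × q matrix and P a q × p matrix over the polynomial ring ℝ[∂], where every entry of P has degree ≤ h and every entry of H has degree ≤ d, acting on tuples of functions as constant-coefficient differential operators. Assume: (i) H • (P • w) = 0 for every p-tuple w of functions of class C^{d+h} (P parametrizes solutions of H); (ii) every q-tuple z of functions of class C^m with H • z = 0 can be written z = P • w for some p-tuple w of functions of class C^{m+h}. Let k_{r+1/2} be the half-integer Matérn kernel with r ≥ m + h and r ≥ d + h (so ν = r + 1/2 ≥ m + h + 1/2). Then the set {P • w : each component w_j is a finite linear combination of kernel sections t ↦ k_{r+1/2}(t, s)} consists of C^m solutions of H • z = 0 and is dense in the C^m solution set of H: for every q-tuple z of C^m functions with H • z = 0, every a < b and every ε > 0, there exists such a w with |z_i^{(j)}(t) − (P • w)_i^{(j)}(t)| < ε for all i, all j ≤ m and all t ∈ [a,b]. -/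

import Mathlib

open Real Finset

/-- The half-integer Matérn kernel with parameters `σ > 0`, `ℓ > 0` and `ν = r + 1/2`. -/
noncomputable def maternKernel (r : ℕ) (σ ℓ : ℝ) (t t' : ℝ) : ℝ :=
  σ ^ 2 * Real.exp (-(Real.sqrt (2 * r + 1) * |t - t'| / ℓ)) *
    ((r.factorial : ℝ) / ((2 * r).factorial : ℝ)) *
    ∑ i ∈ Finset.range (r + 1),
      (((r + i).factorial : ℝ) / ((i.factorial : ℝ) * ((r - i).factorial : ℝ))) *
        (2 * Real.sqrt (2 * r + 1) * |t - t'| / ℓ) ^ (r - i)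

/-- A polynomial `p ∈ ℝ[∂]` acts on a function `f` as the constant-coefficient differential
operator `p • f = Σ_k (coeff of ∂^k) · f^{(k)}`. -/
noncomputable def polyAct (p : Polynomial ℝ) (f : ℝ → ℝ) : ℝ → ℝ :=
  fun t => ∑ k ∈ Finset.range (p.natDegree + 1), p.coeff k * iteratedDeriv k f t

/-- A matrix over `ℝ[∂]` acts on a tuple of functions componentwise. -/
noncomputable def matAct {n q : ℕ} (M : Matrix (Fin n) (Fin q) (Polynomial ℝ))
    (z : Fin q → ℝ → ℝ) : Fin n → ℝ → ℝ :=
  fun i t => ∑ j, polyAct (M i j) (z j) t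

/-- A function `g : ℝ → ℝ` is a finite linear combination of Matérn kernel sections. -/
def IsKernelCombo (r : ℕ) (σ ℓ : ℝ) (g : ℝ → ℝ) : Prop :=
  ∃ (N : ℕ) (c : Fin N → ℝ) (s : Fin N → ℝ),
    g = fun t => ∑ i, c i * maternKernel r σ ℓ t (s i)

open Polynomial in
/-- The polynomial `∑ i, (r+i)!/(i! (r-i)!) X^(r-i)` occurring in the half-integer Matérn kernel. -/
noncomputable def maternPoly (r : ℕ) : ℝ[X] :=
  ∑ i ∈ Finset.range (r + 1),
    Polynomial.monomial (r - i)
      (((r + i).factorial : ℝ) / ((i.factorial : ℝ) * ((r - i).factorial : ℝ)))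

theorem coeff_maternPoly_of_lt {r k : ℕ} (h : r < k) : (maternPoly r).coeff k = 0 := by
  simp only [maternPoly, Polynomial.finsetSum_coeff, Polynomial.coeff_monomial]
  exact Finset.sum_eq_zero fun i _ => if_neg (by omega)

theorem coeff_maternPoly_add (i k : ℕ) :
    (maternPoly (i + k)).coeff k =
      ((2 * i + k).factorial : ℝ) / ((i.factorial : ℝ) * (k.factorial : ℝ)) := by
  simp only [maternPoly, Polynomial.finsetSum_coeff, Polynomial.coeff_monomial]
  rw [Finset.sum_eq_single i]
  · rw [if_pos (by omega), show i + k + i = 2 * i + k by ring, show i + k - i = k by omega]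
  · intro b hb hbi
    rw [Finset.mem_range] at hb
    exact if_neg (by omega)
  · intro h
    simp at h

open Polynomial in
theorem maternPoly_succ_sub_derivative (r : ℕ) :
    maternPoly (r + 1) - 2 * derivative (maternPoly (r + 1)) = X * maternPoly r := by
  ext k
  rw [coeff_sub, show (2 : ℝ[X]) = C 2 from rfl, coeff_C_mul, coeff_derivative]
  rcases k with _ | k
  · have h0 := coeff_maternPoly_add (r + 1) 0
    have h1 := coeff_maternPoly_add r 1
    simp only [add_zero] at h0
    rw [h0, zero_add, h1]
    simp only [mul_coeff_zero, coeff_X_zero, zero_mul]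
    rw [show 2 * (r + 1) = (2 * r + 1) + 1 by ring, Nat.factorial_succ (2 * r + 1),
      Nat.factorial_succ r]
    simp
    field_simp
    ring
  · rw [coeff_X_mul]
    rcases lt_trichotomy r k with h | h | h
    · simp [coeff_maternPoly_of_lt, h, show r + 1 < k + 1 + 1 by omega]
    · subst h
      have h0 := coeff_maternPoly_add 0 r
      have h1 := coeff_maternPoly_add 0 (r + 1)
      simp only [zero_add] at h0 h1
      rw [h0, h1, coeff_maternPoly_of_lt (by omega)]
      simp [Nat.factorial_ne_zero]
    · obtain ⟨i, rfl⟩ := Nat.exists_eq_add_of_lt h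
      have h0 := coeff_maternPoly_add (i + 1) (k + 1)
      have h1 := coeff_maternPoly_add i (k + 1 + 1)
      have h2 := coeff_maternPoly_add (i + 1) k
      rw [show k + i + 1 + 1 = i + 1 + (k + 1) by ring, h0,
        show i + 1 + (k + 1) = i + (k + 1 + 1) by ring, h1,
        show k + i + 1 = i + 1 + k by ring, h2,
        show 2 * (i + 1) + (k + 1) = (2 * i + k + 2) + 1 by ring,
        show 2 * i + (k + 1 + 1) = 2 * i + k + 2 by ring,
        show 2 * (i + 1) + k = 2 * i + k + 2 by ring, Nat.factorial_succ (2 * i + k + 2),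
        Nat.factorial_succ (k + 1), Nat.factorial_succ k, Nat.factorial_succ i]
      push_cast
      field_simp
      ring

open Polynomial in
theorem maternPoly_succ_eq (r : ℕ) :
    maternPoly (r + 1) = C (2 * (2 * r + 1) : ℝ) * maternPoly r + X * maternPoly r
      - 2 * (X * derivative (maternPoly r)) := by
  ext k
  rw [coeff_sub, coeff_add, coeff_C_mul, show (2 : ℝ[X]) = C 2 from rfl, coeff_C_mul]
  rcases k with _ | k
  · have h0 := coeff_maternPoly_add (r + 1) 0
    have h1 := coeff_maternPoly_add r 0
    simp only [add_zero] at h0 h1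
    rw [h0, h1]
    simp only [mul_coeff_zero, coeff_X_zero, zero_mul]
    rw [show 2 * (r + 1) = (2 * r + 1) + 1 by ring, Nat.factorial_succ (2 * r + 1),
      Nat.factorial_succ r, Nat.factorial_succ (2 * r)]
    simp
    field_simp
    ring
  · rw [coeff_X_mul, coeff_X_mul, coeff_derivative]
    rcases lt_trichotomy r k with h | h | h
    · simp [coeff_maternPoly_of_lt, h, show r < k + 1 by omega]
    · subst h
      have h0 := coeff_maternPoly_add 0 r
      have h1 := coeff_maternPoly_add 0 (r + 1)
      simp only [zero_add] at h0 h1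
      rw [h0, h1, coeff_maternPoly_of_lt (by omega)]
      simp [Nat.factorial_ne_zero]
    · obtain ⟨i, rfl⟩ := Nat.exists_eq_add_of_lt h
      have h0 := coeff_maternPoly_add (i + 1) (k + 1)
      have h1 := coeff_maternPoly_add i (k + 1)
      have h2 := coeff_maternPoly_add (i + 1) k
      rw [show k + i + 1 + 1 = i + 1 + (k + 1) by ring, h0,
        show k + i + 1 = i + 1 + k by ring, h2, show i + 1 + k = i + (k + 1) by ring, h1,
        show 2 * (i + 1) + (k + 1) = (2 * i + k + 1) + 1 + 1 by ring,
        show 2 * i + (k + 1) = 2 * i + k + 1 by ring,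
        show 2 * (i + 1) + k = 2 * i + k + 1 + 1 by ring, Nat.factorial_succ (2 * i + k + 1 + 1),
        Nat.factorial_succ (2 * i + k + 1),
        Nat.factorial_succ k, Nat.factorial_succ i]
      push_cast
      field_simp
      ring

/-- The radial profile of the half-integer Matérn kernel, up to a constant factor. -/
noncomputable def maternProfile (r : ℕ) (lam y : ℝ) : ℝ :=
  Real.exp (-(lam * y)) * (maternPoly r).eval (2 * lam * y)

/-- The half-integer Matérn kernel as a function of the difference, up to a constant factor. -/
noncomputable def maternFun (r : ℕ) (lam x : ℝ) : ℝ := maternProfile r lam |x|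

theorem hasDerivAt_maternProfile (r : ℕ) (lam y : ℝ) :
    HasDerivAt (maternProfile r lam)
      (-lam * Real.exp (-(lam * y)) * ((maternPoly r).eval (2 * lam * y)
        - 2 * (maternPoly r).derivative.eval (2 * lam * y))) y := by
  have h1 : HasDerivAt (fun y => -(lam * y)) (-lam) y := by
    convert! ((hasDerivAt_id y).const_mul lam).neg using 1; simp
  have h2 : HasDerivAt (fun y => 2 * lam * y) (2 * lam) y := by
    simpa using (hasDerivAt_id y).const_mul (2 * lam)
  have h3 := (maternPoly r).hasDerivAt (2 * lam * y)
  convert! h1.exp.mul (h3.comp y h2) using 1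
  simp only [Function.comp]
  ring

theorem hasDerivAt_maternProfile_succ (r : ℕ) (lam y : ℝ) :
    HasDerivAt (maternProfile (r + 1) lam) (y * (-2 * lam ^ 2 * maternProfile r lam y)) y := by
  convert hasDerivAt_maternProfile (r + 1) lam y using 1
  have h := congrArg (Polynomial.eval (2 * lam * y)) (maternPoly_succ_sub_derivative r)
  simp only [Polynomial.eval_sub, Polynomial.eval_mul, Polynomial.eval_X,
    Polynomial.eval_ofNat] at h
  rw [h, maternProfile]
  ring

/-- The even extension of a function with derivative `y * g y` is differentiable. -/
theorem hasDerivAt_comp_abs {f g : ℝ → ℝ} (hf : ∀ y, HasDerivAt f (y * g y) y) (x : ℝ) :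
    HasDerivAt (fun x => f |x|) (x * g |x|) x := by
  rcases lt_trichotomy x 0 with hx | rfl | hx
  · convert! (hf |x|).comp x (hasDerivAt_abs_neg hx) using 1
    rw [abs_of_neg hx]; ring
  · have h := hf 0
    rw [zero_mul] at h
    rw [zero_mul, ← hasDerivWithinAt_univ, ← Set.Ici_union_Iic (a := (0 : ℝ))]
    refine HasDerivWithinAt.union ?_ ?_
    · exact h.hasDerivWithinAt.congr (fun y hy => by rw [abs_of_nonneg hy]) (by simp)
    · have h' : HasDerivAt (fun y => f (-y)) 0 0 := by
        have h0 : HasDerivAt f 0 (-0) := by simpa using h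
        convert! h0.comp (0 : ℝ) (hasDerivAt_neg (0 : ℝ)) using 1
        simp
      exact h'.hasDerivWithinAt.congr (fun y hy => by rw [abs_of_nonpos hy]) (by simp)
  · convert! (hf |x|).comp x (hasDerivAt_abs_pos hx) using 1
    rw [abs_of_pos hx]; ring

/-- The odd extension of `y * f y` is differentiable. -/
theorem hasDerivAt_mul_comp_abs {f f' : ℝ → ℝ} (hf : ∀ y, HasDerivAt f (f' y) y) (x : ℝ) :
    HasDerivAt (fun x => x * f |x|) (f |x| + |x| * f' |x|) x := by
  rcases lt_trichotomy x 0 with hx | rfl | hx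
  · convert! (hasDerivAt_id x).mul ((hf |x|).comp x (hasDerivAt_abs_neg hx)) using 1
    simp [abs_of_neg hx]
  · have hc : Continuous fun x => f |x| :=
      (continuous_iff_continuousAt.2 fun y => (hf y).continuousAt).comp continuous_abs
    rw [hasDerivAt_iff_tendsto_slope]
    refine ((hc.tendsto 0).mono_left nhdsWithin_le_nhds).congr' ?_ |>.trans ?_
    · filter_upwards [self_mem_nhdsWithin] with y hy
      have : y ≠ 0 := hy
      simp [slope_def_field, this]
    · simp
  · convert! (hasDerivAt_id x).mul ((hf |x|).comp x (hasDerivAt_abs_pos hx)) using 1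
    simp [abs_of_pos hx]

theorem hasDerivAt_maternFun_succ (r : ℕ) (lam x : ℝ) :
    HasDerivAt (maternFun (r + 1) lam) (-2 * lam ^ 2 * (x * maternFun r lam x)) x := by
  convert! hasDerivAt_comp_abs (hasDerivAt_maternProfile_succ r lam) x using 1
  rw [maternFun]
  ring

theorem hasDerivAt_mul_maternFun (r : ℕ) (lam x : ℝ) :
    HasDerivAt (fun x => x * maternFun r lam x)
      (2 * (r + 1) * maternFun r lam x - maternFun (r + 1) lam x / 2) x := by
  convert! hasDerivAt_mul_comp_abs (hasDerivAt_maternProfile r lam) x using 1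
  have h := congrArg (Polynomial.eval (2 * lam * |x|)) (maternPoly_succ_eq r)
  simp only [Polynomial.eval_sub, Polynomial.eval_add, Polynomial.eval_mul, Polynomial.eval_X,
    Polynomial.eval_C, Polynomial.eval_ofNat] at h
  simp only [maternFun, maternProfile, h]
  ring

theorem continuous_maternFun (r : ℕ) (lam : ℝ) : Continuous (maternFun r lam) :=
  (continuous_iff_continuousAt.2 fun y => (hasDerivAt_maternProfile r lam y).continuousAt).comp
    continuous_abs

theorem contDiff_maternFun (r : ℕ) (lam : ℝ) : ContDiff ℝ r (maternFun r lam) := by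
  induction r with
  | zero => exact contDiff_zero.2 (continuous_maternFun 0 lam)
  | succ r ih =>
    rw [Nat.cast_add, Nat.cast_one, contDiff_succ_iff_deriv]
    refine ⟨fun x => (hasDerivAt_maternFun_succ r lam x).differentiableAt, by simp, ?_⟩
    rw [funext fun x => (hasDerivAt_maternFun_succ r lam x).deriv]
    exact contDiff_const.mul (contDiff_id.mul ih)

theorem maternKernel_eq (r : ℕ) (σ ℓ t s : ℝ) :
    maternKernel r σ ℓ t s =
      σ ^ 2 * ((r.factorial : ℝ) / ((2 * r).factorial : ℝ)) *
        maternFun r (Real.sqrt (2 * r + 1) / ℓ) (t - s) := by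
  have h : ∀ y : ℝ, (maternPoly r).eval y = ∑ i ∈ Finset.range (r + 1),
      (((r + i).factorial : ℝ) / ((i.factorial : ℝ) * ((r - i).factorial : ℝ))) * y ^ (r - i) := by
    intro y
    simp [maternPoly, Polynomial.eval_finsetSum]
  rw [maternKernel, maternFun, maternProfile, h,
    show Real.sqrt (2 * r + 1) / ℓ * |t - s| = Real.sqrt (2 * r + 1) * |t - s| / ℓ by ring,
    show 2 * (Real.sqrt (2 * r + 1) / ℓ) * |t - s| = 2 * Real.sqrt (2 * r + 1) * |t - s| / ℓ by ring]
  ring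

open scoped ContDiff

theorem HasCompactSupport.integrable_continuous_mul {f φ : ℝ → ℝ} (hf : Continuous f)
    (hφ : Continuous φ) (hφc : HasCompactSupport φ) :
    MeasureTheory.Integrable fun s => f s * φ s :=
  (hf.mul hφ).integrable_of_hasCompactSupport hφc.mul_left

theorem HasCompactSupport.integral_comp_sub_mul_deriv {f f' φ : ℝ → ℝ}
    (hf : ∀ x, HasDerivAt f (f' x) x) (hf' : Continuous f') (hφ : ContDiff ℝ 1 φ)
    (hφc : HasCompactSupport φ) (t : ℝ) :
    ∫ s, f (t - s) * deriv φ s = ∫ s, f' (t - s) * φ s := by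
  have hfc : Continuous f := continuous_iff_continuousAt.2 fun y => (hf y).continuousAt
  have hd : ∀ s, HasDerivAt (fun s => f (t - s)) (-f' (t - s)) s := fun s => by
    convert! (hf (t - s)).comp s ((hasDerivAt_id s).const_sub t) using 1
    ring
  have ht : Continuous fun s : ℝ => t - s := by fun_prop
  have hf't : Continuous fun s : ℝ => -f' (t - s) := (hf'.comp ht).neg
  rw [MeasureTheory.integral_mul_deriv_eq_deriv_mul_of_integrable (u := fun s => f (t - s))
    (u' := fun s => -f' (t - s)) (v := φ) (v' := deriv φ) (fun s _ => hd s)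
    (fun s _ => (hφ.differentiable one_ne_zero s).hasDerivAt)
    (HasCompactSupport.integrable_continuous_mul (hfc.comp ht) hφ.continuous_deriv_one hφc.deriv)
    (HasCompactSupport.integrable_continuous_mul hf't hφ.continuous hφc)
    (HasCompactSupport.integrable_continuous_mul (hfc.comp ht) hφ.continuous hφc)]
  simp [MeasureTheory.integral_neg]

/-- The differential operator `λ² - ∂²`, whose `(r+1)`-st power annihilates the Matérn kernel away
from the diagonal. -/
noncomputable def helmholtz (lam : ℝ) (φ : ℝ → ℝ) (s : ℝ) : ℝ :=
  lam ^ 2 * φ s - deriv (deriv φ) s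

theorem ContDiff.deriv_infty {φ : ℝ → ℝ} (h : ContDiff ℝ ∞ φ) : ContDiff ℝ ∞ (deriv φ) :=
  (contDiff_infty_iff_deriv.1 h).2

theorem ContDiff.helmholtz {lam : ℝ} {φ : ℝ → ℝ} (h : ContDiff ℝ ∞ φ) :
    ContDiff ℝ ∞ (helmholtz lam φ) :=
  (contDiff_const.mul h).sub h.deriv_infty.deriv_infty

theorem HasCompactSupport.helmholtz {lam : ℝ} {φ : ℝ → ℝ} (h : HasCompactSupport φ) :
    HasCompactSupport (helmholtz lam φ) :=
  HasCompactSupport.sub (f := fun s => lam ^ 2 * φ s) h.mul_left h.deriv.deriv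

theorem ContDiff.iteratedDeriv_infty {φ : ℝ → ℝ} (h : ContDiff ℝ ∞ φ) (j : ℕ) :
    ContDiff ℝ ∞ (iteratedDeriv j φ) := by
  rw [iteratedDeriv_eq_iterate]
  exact h.iterate_deriv j

theorem HasCompactSupport.iteratedDeriv {φ : ℝ → ℝ} (h : HasCompactSupport φ) (j : ℕ) :
    HasCompactSupport (iteratedDeriv j φ) := by
  induction j with
  | zero => rwa [iteratedDeriv_zero]
  | succ j ih => rw [iteratedDeriv_succ]; exact ih.deriv

theorem iteratedDeriv_helmholtz {lam : ℝ} {φ : ℝ → ℝ} (h : ContDiff ℝ ∞ φ) (j : ℕ) :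
    iteratedDeriv j (helmholtz lam φ) = helmholtz lam (iteratedDeriv j φ) := by
  induction j with
  | zero => simp
  | succ j ih =>
    have hj := h.iteratedDeriv_infty j
    have hd : ∀ {ψ : ℝ → ℝ}, ContDiff ℝ ∞ ψ → Differentiable ℝ ψ :=
      fun hψ => hψ.differentiable (by simp)
    rw [iteratedDeriv_succ, ih, iteratedDeriv_succ]
    funext s
    exact (((hd hj s).hasDerivAt.const_mul _).sub
      (hd hj.deriv_infty.deriv_infty s).hasDerivAt).deriv

theorem integral_maternFun_zero_mul_helmholtz {lam : ℝ} {φ : ℝ → ℝ} (h : ContDiff ℝ ∞ φ)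
    (hc : HasCompactSupport φ) (t : ℝ) :
    ∫ s, maternFun 0 lam (t - s) * helmholtz lam φ s = 2 * lam * φ t := by
  have hd : ∀ {ψ : ℝ → ℝ}, ContDiff ℝ ∞ ψ → ∀ s, HasDerivAt ψ (deriv ψ s) s :=
    fun hψ s => (hψ.differentiable (by simp) s).hasDerivAt
  have hK : ∀ x, maternFun 0 lam x = Real.exp (-(lam * |x|)) := by
    intro x
    simp [maternFun, maternProfile, maternPoly]
  have hexp : ∀ c s : ℝ, HasDerivAt (fun s => Real.exp (c * (t - s)))
      (-c * Real.exp (c * (t - s))) s := by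
    intro c s
    convert! (((hasDerivAt_id s).const_sub t).const_mul c).exp using 1
    simp
    ring
  have hexpc : ∀ c : ℝ, ContDiff ℝ ∞ fun s => Real.exp (c * (t - s)) := fun c => by fun_prop
  have hside : ∀ c : ℝ, c ^ 2 = lam ^ 2 → ∀ s,
      HasDerivAt (fun s => Real.exp (c * (t - s)) * (-c * φ s - deriv φ s))
        (Real.exp (c * (t - s)) * helmholtz lam φ s) s := by
    intro c hcl s
    convert! (hexp c s).mul (((hd h s).const_mul (-c)).sub (hd h.deriv_infty s)) using 1
    rw [helmholtz, ← hcl]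
    simp only [Pi.sub_apply]
    ring
  have hsmooth : ∀ c : ℝ,
      ContDiff ℝ 1 fun s => Real.exp (c * (t - s)) * (-c * φ s - deriv φ s) := fun c =>
    ((hexpc c).mul ((contDiff_const.mul h).sub h.deriv_infty)).of_le (by simp)
  have hcs : ∀ c : ℝ,
      HasCompactSupport fun s => Real.exp (c * (t - s)) * (-c * φ s - deriv φ s) := fun c =>
    HasCompactSupport.mul_left (HasCompactSupport.sub (f := fun s => -c * φ s) hc.mul_left hc.deriv)
  have hl := HasCompactSupport.integral_Iic_deriv_eq (hsmooth (-lam)) (hcs (-lam)) t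
  have hr := HasCompactSupport.integral_Ioi_deriv_eq (hsmooth lam) (hcs lam) t
  simp only [fun s => (hside (-lam) (by ring) s).deriv] at hl
  simp only [fun s => (hside lam rfl s).deriv] at hr
  have hint : MeasureTheory.Integrable fun s => maternFun 0 lam (t - s) * helmholtz lam φ s :=
    HasCompactSupport.integrable_continuous_mul
      ((continuous_maternFun 0 lam).comp (by fun_prop)) h.helmholtz.continuous hc.helmholtz
  rw [← MeasureTheory.integral_add_compl (measurableSet_Iic (a := t)) hint, Set.compl_Iic,
    MeasureTheory.setIntegral_congr_fun (g := fun s => Real.exp (-lam * (t - s)) * helmholtz lam φ s)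
      measurableSet_Iic ?_, hl,
    MeasureTheory.setIntegral_congr_fun (g := fun s => Real.exp (lam * (t - s)) * helmholtz lam φ s)
      measurableSet_Ioi ?_, hr]
  · simp
    ring
  · intro s hs
    simp only [hK, abs_of_neg (sub_neg.2 (Set.mem_Ioi.1 hs))]
    ring_nf
  · intro s hs
    simp only [hK, abs_of_nonneg (sub_nonneg.2 (Set.mem_Iic.1 hs))]
    ring_nf

theorem integral_maternFun_succ_mul_helmholtz (r : ℕ) {lam : ℝ} {φ : ℝ → ℝ} (h : ContDiff ℝ ∞ φ)
    (hc : HasCompactSupport φ) (t : ℝ) :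
    ∫ s, maternFun (r + 1) lam (t - s) * helmholtz lam φ s =
      4 * lam ^ 2 * (r + 1) * ∫ s, maternFun r lam (t - s) * φ s := by
  have ht : Continuous fun s : ℝ => t - s := by fun_prop
  have hi : ∀ (k : ℕ) {ψ : ℝ → ℝ}, Continuous ψ → HasCompactSupport ψ →
      MeasureTheory.Integrable fun s => maternFun k lam (t - s) * ψ s := fun k _ hψ hψc =>
    HasCompactSupport.integrable_continuous_mul ((continuous_maternFun k lam).comp ht) hψ hψc
  have hr := continuous_maternFun r lam
  have hr1 := continuous_maternFun (r + 1) lam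
  have h1 := HasCompactSupport.integral_comp_sub_mul_deriv (hasDerivAt_maternFun_succ r lam)
    (by fun_prop) (h.deriv_infty.of_le (by simp)) hc.deriv t
  have h2 := HasCompactSupport.integral_comp_sub_mul_deriv (hasDerivAt_mul_maternFun r lam)
    (by fun_prop) (h.of_le (by simp)) hc t
  have h3 : ∫ s, -2 * lam ^ 2 * ((t - s) * maternFun r lam (t - s)) * deriv φ s =
      -2 * lam ^ 2 * ∫ s, (t - s) * maternFun r lam (t - s) * deriv φ s := by
    rw [← MeasureTheory.integral_const_mul]
    simp only [mul_assoc]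
  have h4 : ∫ s, (2 * (r + 1) * maternFun r lam (t - s) - maternFun (r + 1) lam (t - s) / 2) * φ s =
      2 * (r + 1) * (∫ s, maternFun r lam (t - s) * φ s) -
        (∫ s, maternFun (r + 1) lam (t - s) * φ s) / 2 := by
    rw [← MeasureTheory.integral_const_mul, ← MeasureTheory.integral_div,
      ← MeasureTheory.integral_sub ((hi r h.continuous hc).const_mul _)
        ((hi (r + 1) h.continuous hc).div_const _)]
    congr 1
    funext s
    ring
  have h5 : ∫ s, maternFun (r + 1) lam (t - s) * helmholtz lam φ s =
      lam ^ 2 * (∫ s, maternFun (r + 1) lam (t - s) * φ s) -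
        ∫ s, maternFun (r + 1) lam (t - s) * deriv (deriv φ) s := by
    rw [← MeasureTheory.integral_const_mul,
      ← MeasureTheory.integral_sub ((hi (r + 1) h.continuous hc).const_mul _)
        (hi (r + 1) h.deriv_infty.deriv_infty.continuous hc.deriv.deriv)]
    congr 1
    funext s
    rw [helmholtz]
    ring
  rw [h5, h1, h3, h2, h4]
  ring

/-- Every test function is, up to a nonzero factor, a convolution of the Matérn kernel with a
test function, and so are its derivatives. -/
theorem exists_integral_maternFun_mul_eq (r : ℕ) {lam : ℝ} (hlam : 0 < lam) {ψ : ℝ → ℝ}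
    (h : ContDiff ℝ ∞ ψ) (hc : HasCompactSupport ψ) :
    ∃ φ : ℝ → ℝ, ContDiff ℝ ∞ φ ∧ HasCompactSupport φ ∧ ∃ C : ℝ, C ≠ 0 ∧
      ∀ (j : ℕ) (t : ℝ), ∫ s, maternFun r lam (t - s) * iteratedDeriv j φ s =
        C * iteratedDeriv j ψ t := by
  induction r with
  | zero =>
    refine ⟨helmholtz lam ψ, h.helmholtz, hc.helmholtz, 2 * lam, by positivity, fun j t => ?_⟩
    rw [iteratedDeriv_helmholtz h]
    exact integral_maternFun_zero_mul_helmholtz (h.iteratedDeriv_infty j) (hc.iteratedDeriv j) t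
  | succ r ih =>
    obtain ⟨φ, hφ, hφc, C, hC, hφψ⟩ := ih
    refine ⟨helmholtz lam φ, hφ.helmholtz, hφc.helmholtz, 4 * lam ^ 2 * (r + 1) * C,
      by positivity, fun j t => ?_⟩
    rw [iteratedDeriv_helmholtz hφ, integral_maternFun_succ_mul_helmholtz r
      (hφ.iteratedDeriv_infty j) (hφc.iteratedDeriv j) t, hφψ]
    ring

theorem integral_iteratedDeriv_maternFun_mul {r : ℕ} {lam : ℝ} {φ : ℝ → ℝ} (h : ContDiff ℝ ∞ φ)
    (hc : HasCompactSupport φ) {i : ℕ} (hi : i ≤ r) (t : ℝ) :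
    ∫ s, iteratedDeriv i (maternFun r lam) (t - s) * φ s =
      ∫ s, maternFun r lam (t - s) * iteratedDeriv i φ s := by
  induction i generalizing φ with
  | zero => simp
  | succ i ih =>
    have hcd := contDiff_maternFun r lam
    rw [iteratedDeriv_succ, iteratedDeriv_succ', ← ih h.deriv_infty hc.deriv (by omega)]
    refine (HasCompactSupport.integral_comp_sub_mul_deriv (fun x => ?_) ?_
      (h.of_le (by simp)) hc t).symm
    · exact (hcd.differentiable_iteratedDeriv i (by exact_mod_cast hi) x).hasDerivAt
    · rw [← iteratedDeriv_succ]
      exact hcd.continuous_iteratedDeriv (i + 1) (by exact_mod_cast hi)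

theorem Submodule.integral_mem_of_isClosed {α E : Type*} [MeasurableSpace α]
    {μ : MeasureTheory.Measure α} [NormedAddCommGroup E] [NormedSpace ℝ E] [CompleteSpace E]
    (S : Submodule ℝ E) (hS : IsClosed (S : Set E)) {F : α → E} (hF : ∀ s, F s ∈ S)
    (hint : MeasureTheory.Integrable F μ) : ∫ s, F s ∂μ ∈ S := by
  by_contra hmem
  obtain ⟨f, u, hfS, hu⟩ := geometric_hahn_banach_closed_point S.convex hS hmem
  have hzero : ∀ x ∈ S, f x = 0 := by
    intro x hx
    by_contra hne
    have h := hfS _ (S.smul_mem (u / f x) hx)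
    rw [map_smul, smul_eq_mul, div_mul_cancel₀ _ hne] at h
    exact lt_irrefl _ h
  have h0 := hfS 0 S.zero_mem
  rw [← f.integral_comp_comm hint] at hu
  simp only [fun s => hzero _ (hF s), MeasureTheory.integral_zero] at hu
  rw [map_zero] at h0
  exact lt_asymm h0 hu

/-- The vector of translated derivatives `(k⁽ʲ⁾(t - s))` with `j ≤ M`, as a continuous function
of `t ∈ [a, b]` depending continuously on `s`. -/
noncomputable def jetTranslate {k : ℝ → ℝ} {M : ℕ} (hk : ContDiff ℝ M k) (a b : ℝ) :
    C(ℝ, C(Set.Icc a b, Fin (M + 1) → ℝ)) :=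
  ContinuousMap.curry ⟨fun x j => iteratedDeriv j k ((x.2 : ℝ) - x.1), by
    refine continuous_pi fun j => ?_
    exact (hk.continuous_iteratedDeriv j
      (by exact_mod_cast Nat.lt_succ_iff.1 j.2)).comp (by fun_prop)⟩

theorem jetTranslate_apply {k : ℝ → ℝ} {M : ℕ} (hk : ContDiff ℝ M k) {a b : ℝ} (s : ℝ)
    (t : Set.Icc a b) (j : Fin (M + 1)) :
    jetTranslate hk a b s t j = iteratedDeriv j k ((t : ℝ) - s) := rfl

/-- On compact intervals, test functions are `C^M` limits of combinations of translates of the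
Matérn kernel. -/
theorem exists_maternFun_combo_near_of_hasCompactSupport {r M : ℕ} (hM : M ≤ r) {lam : ℝ}
    (hlam : 0 < lam) {ψ : ℝ → ℝ} (h : ContDiff ℝ ∞ ψ) (hc : HasCompactSupport ψ) (a b : ℝ)
    {ε : ℝ} (hε : 0 < ε) :
    ∃ (N : ℕ) (c : Fin N → ℝ) (s : Fin N → ℝ), ∀ j ≤ M, ∀ t ∈ Set.Icc a b,
      |iteratedDeriv j ψ t -
        iteratedDeriv j (fun t => ∑ i, c i * maternFun r lam (t - s i)) t| < ε := by
  have hk : ContDiff ℝ M (maternFun r lam) :=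
    (contDiff_maternFun r lam).of_le (by exact_mod_cast hM)
  obtain ⟨φ, hφ, hφc, C, hC, hφψ⟩ := exists_integral_maternFun_mul_eq r hlam h hc
  set J := jetTranslate hk a b
  have hint : MeasureTheory.Integrable fun s => φ s • J s :=
    (hφ.continuous.smul J.continuous).integrable_of_hasCompactSupport hφc.smul_right
  set S := (Submodule.span ℝ (Set.range J)).topologicalClosure
  have hmem : ∫ s, φ s • J s ∈ S :=
    S.integral_mem_of_isClosed (Submodule.isClosed_topologicalClosure _) (fun s => S.smul_mem _
      (Submodule.le_topologicalClosure _ (Submodule.subset_span ⟨s, rfl⟩))) hint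
  have heval : ∀ (t : Set.Icc a b) (j : Fin (M + 1)),
      (C⁻¹ • ∫ s, φ s • J s) t j = iteratedDeriv j ψ t := by
    intro t j
    have hcomm := ((ContinuousLinearMap.proj (R := ℝ) (φ := fun _ : Fin (M + 1) => ℝ) j).comp
      (ContinuousMap.evalCLM ℝ t)).integral_comp_comm hint
    have hj : (j : ℕ) ≤ M := Nat.lt_succ_iff.1 j.2
    have h2 : ∫ s, φ s * iteratedDeriv j (maternFun r lam) ((t : ℝ) - s) =
        C * iteratedDeriv j ψ t := by
      rw [← hφψ, ← integral_iteratedDeriv_maternFun_mul hφ hφc (hj.trans hM)]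
      simp only [mul_comm]
    calc (C⁻¹ • ∫ s, φ s • J s) t j = C⁻¹ * (∫ s, φ s • J s) t j := rfl
      _ = C⁻¹ * ∫ s, φ s * iteratedDeriv j (maternFun r lam) ((t : ℝ) - s) :=
        congrArg (C⁻¹ * ·) hcomm.symm
      _ = iteratedDeriv j ψ t := by rw [h2, inv_mul_cancel_left₀ hC]
  obtain ⟨g, hgS, hg⟩ := Metric.mem_closure_iff.1 (S.smul_mem C⁻¹ hmem) ε hε
  obtain ⟨N, c, x, rfl⟩ := (Submodule.mem_span_set' (s := Set.range J)).1 hgS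
  choose s hs using fun i => (x i).2
  refine ⟨N, c, s, fun j hj t ht => ?_⟩
  have hdist := ((ContinuousMap.dist_lt_iff hε).1 hg ⟨t, ht⟩)
  have hdistj := (dist_le_pi_dist _ _ (⟨j, Nat.lt_succ_of_le hj⟩ : Fin (M + 1))).trans_lt hdist
  rw [heval, Real.dist_eq] at hdistj
  have hcombo : iteratedDeriv j (fun t => ∑ i, c i * maternFun r lam (t - s i)) t =
      (∑ i, c i • (x i : C(Set.Icc a b, Fin (M + 1) → ℝ))) ⟨t, ht⟩ ⟨j, Nat.lt_succ_of_le hj⟩ := by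
    have hsmooth : ∀ i, ContDiff ℝ j fun t => c i * maternFun r lam (t - s i) := fun i =>
      contDiff_const.mul ((hk.of_le (by exact_mod_cast hj)).comp (contDiff_id.sub contDiff_const))
    rw [iteratedDeriv_fun_sum fun i _ => (hsmooth i).contDiffAt]
    simp only [ContinuousMap.coe_sum, ContinuousMap.coe_smul, Finset.sum_apply, Pi.smul_apply,
      smul_eq_mul, ← hs]
    refine Finset.sum_congr rfl fun i _ => ?_
    rw [iteratedDeriv_const_mul_field, jetTranslate_apply, iteratedDeriv_comp_sub_const]
  rwa [hcombo]

/-- A `C^M` function is a `C^M` limit, on a compact interval, of smooth functions. -/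
theorem exists_contDiff_iteratedDeriv_near {M : ℕ} {w : ℝ → ℝ} (hw : ContDiff ℝ M w) {a b : ℝ}
    (hab : a ≤ b) {ε : ℝ} (hε : 0 < ε) :
    ∃ g : ℝ → ℝ, ContDiff ℝ ∞ g ∧ ∀ j ≤ M, ∀ t ∈ Set.Icc a b,
      |iteratedDeriv j w t - iteratedDeriv j g t| < ε := by
  induction M generalizing w ε with
  | zero =>
    obtain ⟨P, hP⟩ := exists_polynomial_near_of_continuousOn a b w hw.continuous.continuousOn ε hε
    refine ⟨fun t => P.eval t, P.contDiff_aeval _, fun j hj t ht => ?_⟩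
    rw [Nat.le_zero.1 hj, iteratedDeriv_zero, iteratedDeriv_zero, abs_sub_comm]
    exact hP t ht
  | succ M ih =>
    rw [Nat.cast_add, Nat.cast_one, contDiff_succ_iff_deriv] at hw
    obtain ⟨hwd, -, hw'⟩ := hw
    have hpos : 0 < b - a + 1 := by linarith
    obtain ⟨g, hg, hgw⟩ := ih hw' (div_pos hε hpos)
    have hle : ε / (b - a + 1) ≤ ε := div_le_self hε.le (by linarith)
    have hG : ∀ t, HasDerivAt (fun t => w a + ∫ x in a..t, g x) (g t) t := fun t =>
      (intervalIntegral.integral_hasDerivAt_right (hg.continuous.intervalIntegrable _ _)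
        hg.continuous.stronglyMeasurable.stronglyMeasurableAtFilter
        hg.continuous.continuousAt).const_add _
    have hGd : deriv (fun t => w a + ∫ x in a..t, g x) = g := funext fun t => (hG t).deriv
    refine ⟨fun t => w a + ∫ x in a..t, g x,
      contDiff_infty_iff_deriv.2 ⟨fun t => (hG t).differentiableAt, by rwa [hGd]⟩, ?_⟩
    intro j hj t ht
    rcases j with _ | j
    · simp only [iteratedDeriv_zero]
      have hbound := (convex_Icc a b).norm_image_sub_le_of_norm_hasDerivWithin_le
        (f := fun t => w t - (w a + ∫ x in a..t, g x)) (C := ε / (b - a + 1))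
        (fun x _ => ((hwd x).hasDerivAt.sub (hG x)).hasDerivWithinAt)
        (fun x hx => by simpa using (hgw 0 (Nat.zero_le _) x hx).le)
        (Set.left_mem_Icc.2 hab) ht
      simp only [intervalIntegral.integral_same, add_zero, sub_self, sub_zero,
        Real.norm_eq_abs] at hbound
      rw [abs_of_nonneg (sub_nonneg.2 ht.1)] at hbound
      calc _ ≤ ε / (b - a + 1) * (t - a) := hbound
        _ < ε / (b - a + 1) * (b - a + 1) :=
          mul_lt_mul_of_pos_left (by linarith [ht.2]) (div_pos hε hpos)
        _ = ε := div_mul_cancel₀ _ hpos.ne'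
    · rw [iteratedDeriv_succ', iteratedDeriv_succ', hGd]
      exact (hgw j (by omega) t ht).trans_le hle

/-- On compact intervals, `C^M` functions are `C^M` limits of combinations of translates of the
Matérn kernel. -/
theorem exists_maternFun_combo_near {r M : ℕ} (hM : M ≤ r) {lam : ℝ} (hlam : 0 < lam)
    {w : ℝ → ℝ} (hw : ContDiff ℝ M w) {a b : ℝ} (hab : a < b) {ε : ℝ} (hε : 0 < ε) :
    ∃ (N : ℕ) (c : Fin N → ℝ) (s : Fin N → ℝ), ∀ j ≤ M, ∀ t ∈ Set.Icc a b,
      |iteratedDeriv j w t -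
        iteratedDeriv j (fun t => ∑ i, c i * maternFun r lam (t - s i)) t| < ε := by
  obtain ⟨g, hg, hgw⟩ := exists_contDiff_iteratedDeriv_near hw hab.le (half_pos hε)
  let χ : ContDiffBump ((a + b) / 2) :=
    { rIn := b - a
      rOut := 2 * (b - a)
      rIn_pos := by linarith
      rIn_lt_rOut := by linarith }
  obtain ⟨N, c, s, hcs⟩ := exists_maternFun_combo_near_of_hasCompactSupport hM hlam
    (ψ := fun t => χ t * g t) (χ.contDiff.mul hg) χ.hasCompactSupport.mul_right a b (half_pos hε)
  refine ⟨N, c, s, fun j hj t ht => ?_⟩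
  have heq : (fun t => χ t * g t) =ᶠ[nhds t] g := by
    have hball : t ∈ Metric.ball ((a + b) / 2) (b - a) := by
      rw [Real.ball_eq_Ioo]
      constructor <;> linarith [ht.1, ht.2]
    filter_upwards [Metric.isOpen_ball.mem_nhds hball] with u hu
    rw [χ.one_of_mem_closedBall (Metric.ball_subset_closedBall hu), one_mul]
  have h1 := hcs j hj t ht
  rw [heq.iteratedDeriv_eq j] at h1
  calc _ ≤ _ := abs_sub_le _ (iteratedDeriv j g t) _
    _ < ε / 2 + ε / 2 := add_lt_add (hgw j hj t ht) h1
    _ = ε := add_halves ε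

theorem exists_isKernelCombo_near {r M : ℕ} (hM : M ≤ r) {σ ℓ : ℝ} (hσ : 0 < σ) (hℓ : 0 < ℓ)
    {w : ℝ → ℝ} (hw : ContDiff ℝ M w) {a b : ℝ} (hab : a < b) {ε : ℝ} (hε : 0 < ε) :
    ∃ g, IsKernelCombo r σ ℓ g ∧ ∀ j ≤ M, ∀ t ∈ Set.Icc a b,
      |iteratedDeriv j w t - iteratedDeriv j g t| < ε := by
  have hlam : 0 < Real.sqrt (2 * r + 1) / ℓ := by positivity
  obtain ⟨N, c, s, h⟩ := exists_maternFun_combo_near hM hlam hw hab hε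
  refine ⟨_, ⟨N, fun i => c i / (σ ^ 2 * ((r.factorial : ℝ) / ((2 * r).factorial : ℝ))), s, ?_⟩, h⟩
  have hne : σ ^ 2 * ((r.factorial : ℝ) / ((2 * r).factorial : ℝ)) ≠ 0 := by positivity
  funext t
  refine Finset.sum_congr rfl fun i _ => ?_
  rw [maternKernel_eq, ← mul_assoc, div_mul_cancel₀ _ hne]

theorem IsKernelCombo.contDiff {r : ℕ} {σ ℓ : ℝ} {g : ℝ → ℝ} (hg : IsKernelCombo r σ ℓ g) :
    ContDiff ℝ r g := by
  obtain ⟨N, c, s, rfl⟩ := hg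
  simp only [maternKernel_eq]
  exact ContDiff.sum fun i _ => contDiff_const.mul (contDiff_const.mul
    ((contDiff_maternFun r _).comp (contDiff_id.sub contDiff_const)))

theorem ContDiff.iteratedDeriv_of_add {f : ℝ → ℝ} {m k : ℕ} (hf : ContDiff ℝ (m + k) f) :
    ContDiff ℝ m (iteratedDeriv k f) := by
  rw [iteratedDeriv_eq_iterate]
  exact hf.iterate_deriv' m k

theorem ContDiff.polyAct {f : ℝ → ℝ} {m h : ℕ} (hf : ContDiff ℝ (m + h) f) {p : Polynomial ℝ}
    (hp : p.natDegree ≤ h) : ContDiff ℝ m (polyAct p f) :=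
  ContDiff.sum fun k hk => contDiff_const.mul <| ContDiff.iteratedDeriv_of_add <| hf.of_le <| by
    have := Finset.mem_range.1 hk
    exact_mod_cast (by omega : m + k ≤ m + h)

theorem ContDiff.matAct {q p m h : ℕ} {P : Matrix (Fin q) (Fin p) (Polynomial ℝ)}
    (hP : ∀ i j, (P i j).natDegree ≤ h) {w : Fin p → ℝ → ℝ} (hw : ∀ j, ContDiff ℝ (m + h) (w j))
    (i : Fin q) : ContDiff ℝ m (matAct P w i) :=
  ContDiff.sum fun j _ => (hw j).polyAct (hP i j)

theorem iteratedDeriv_polyAct {f : ℝ → ℝ} {m h : ℕ} (hf : ContDiff ℝ (m + h) f)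
    {p : Polynomial ℝ} (hp : p.natDegree ≤ h) {j : ℕ} (hj : j ≤ m) (t : ℝ) :
    iteratedDeriv j (polyAct p f) t =
      ∑ k ∈ Finset.range (p.natDegree + 1), p.coeff k * iteratedDeriv (j + k) f t := by
  unfold polyAct
  rw [iteratedDeriv_fun_sum]
  · refine Finset.sum_congr rfl fun k _ => ?_
    rw [iteratedDeriv_const_mul_field, iteratedDeriv_eq_iterate, iteratedDeriv_eq_iterate,
      iteratedDeriv_eq_iterate, Function.iterate_add_apply]
  · intro k hk
    refine (contDiff_const.mul <| ContDiff.iteratedDeriv_of_add <| hf.of_le ?_).contDiffAt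
    have := Finset.mem_range.1 hk
    exact_mod_cast (by omega : j + k ≤ m + h)

theorem iteratedDeriv_matAct {q p m h : ℕ} {P : Matrix (Fin q) (Fin p) (Polynomial ℝ)}
    (hP : ∀ i j, (P i j).natDegree ≤ h) {w : Fin p → ℝ → ℝ} (hw : ∀ j, ContDiff ℝ (m + h) (w j))
    (i : Fin q) {j : ℕ} (hj : j ≤ m) (t : ℝ) :
    iteratedDeriv j (matAct P w i) t = ∑ l, ∑ k ∈ Finset.range ((P i l).natDegree + 1),
      (P i l).coeff k * iteratedDeriv (j + k) (w l) t := by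
  unfold matAct
  rw [iteratedDeriv_fun_sum fun l _ =>
    (((hw l).polyAct (hP i l)).of_le (by exact_mod_cast hj)).contDiffAt]
  exact Finset.sum_congr rfl fun l _ => iteratedDeriv_polyAct (hw l) (hP i l) hj t

/-- The operator `P` is bounded from `C^(m+h)` to `C^m`. -/
theorem abs_iteratedDeriv_matAct_sub_le {q p m h : ℕ} {P : Matrix (Fin q) (Fin p) (Polynomial ℝ)}
    (hP : ∀ i j, (P i j).natDegree ≤ h) {w v : Fin p → ℝ → ℝ}
    (hw : ∀ j, ContDiff ℝ (m + h) (w j)) (hv : ∀ j, ContDiff ℝ (m + h) (v j)) {t δ : ℝ}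
    (hδ : ∀ l, ∀ j ≤ m + h, |iteratedDeriv j (w l) t - iteratedDeriv j (v l) t| ≤ δ)
    (i : Fin q) {j : ℕ} (hj : j ≤ m) :
    |iteratedDeriv j (matAct P w i) t - iteratedDeriv j (matAct P v i) t| ≤
      (∑ l, ∑ k ∈ Finset.range ((P i l).natDegree + 1), |(P i l).coeff k|) * δ := by
  rw [iteratedDeriv_matAct hP hw i hj, iteratedDeriv_matAct hP hv i hj,
    ← Finset.sum_sub_distrib, Finset.sum_mul]
  refine (Finset.abs_sum_le_sum_abs _ _).trans (Finset.sum_le_sum fun l _ => ?_)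
  rw [← Finset.sum_sub_distrib, Finset.sum_mul]
  refine (Finset.abs_sum_le_sum_abs _ _).trans (Finset.sum_le_sum fun k hk => ?_)
  rw [← mul_sub, abs_mul]
  have := Finset.mem_range.1 hk
  have := hP i l
  exact mul_le_mul_of_nonneg_left (hδ l (j + k) (by omega)) (abs_nonneg _)

/-- Theorem 2 of the paper: if `P` parametrizes the `C^m` solution set of the operator matrix
`H`, then `P` applied to tuples of finite linear combinations of Matérn kernel sections
(with `ν = r + 1/2`, `r ≥ m + h`, `r ≥ d + h`) yields `C^m` solutions of `H • z = 0`,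
and these are dense in the `C^m` solution set of `H`. -/
theorem lodegp_matern_dense (m h d n q p : ℕ)
    (H : Matrix (Fin n) (Fin q) (Polynomial ℝ)) (P : Matrix (Fin q) (Fin p) (Polynomial ℝ))
    (hPdeg : ∀ i j, (P i j).natDegree ≤ h) (hHdeg : ∀ i j, (H i j).natDegree ≤ d)
    (hHP : ∀ w : Fin p → ℝ → ℝ, (∀ j, ContDiff ℝ (d + h) (w j)) →
      matAct H (matAct P w) = 0)
    (hparam : ∀ z : Fin q → ℝ → ℝ, (∀ i, ContDiff ℝ m (z i)) → matAct H z = 0 →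
      ∃ w : Fin p → ℝ → ℝ, (∀ j, ContDiff ℝ (m + h) (w j)) ∧ z = matAct P w)
    (r : ℕ) (hr1 : m + h ≤ r) (hr2 : d + h ≤ r) (σ ℓ : ℝ) (hσ : 0 < σ) (hℓ : 0 < ℓ) :
    (∀ w : Fin p → ℝ → ℝ, (∀ j, IsKernelCombo r σ ℓ (w j)) →
      (∀ i, ContDiff ℝ m (matAct P w i)) ∧ matAct H (matAct P w) = 0) ∧
    (∀ z : Fin q → ℝ → ℝ, (∀ i, ContDiff ℝ m (z i)) → matAct H z = 0 →
      ∀ a b : ℝ, a < b → ∀ ε : ℝ, 0 < ε →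
        ∃ w : Fin p → ℝ → ℝ, (∀ j, IsKernelCombo r σ ℓ (w j)) ∧
          ∀ i, ∀ j ≤ m, ∀ t ∈ Set.Icc a b,
            |iteratedDeriv j (z i) t - iteratedDeriv j (matAct P w i) t| < ε) := by
  have hle : ∀ {x : ℕ}, x + h ≤ r → ∀ {g : ℝ → ℝ}, IsKernelCombo r σ ℓ g →
      ContDiff ℝ (x + h) g := fun hx _ hg => hg.contDiff.of_le (by exact_mod_cast hx)
  refine ⟨fun w hw => ⟨ContDiff.matAct hPdeg fun j => hle hr1 (hw j),
    hHP w fun j => hle hr2 (hw j)⟩, ?_⟩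
  intro z hz hHz a b hab ε hε
  obtain ⟨w, hw, rfl⟩ := hparam z hz hHz
  set B : Fin q → ℝ := fun i =>
    ∑ l, ∑ k ∈ Finset.range ((P i l).natDegree + 1), |(P i l).coeff k|
  have hB : ∀ i, 0 ≤ B i := fun i => by positivity
  have hBs : ∀ i, B i ≤ ∑ i, B i := fun i =>
    Finset.single_le_sum (fun i _ => hB i) (Finset.mem_univ i)
  have hpos : 0 < ∑ i, B i + 1 := by positivity
  have hδ : 0 < ε / (∑ i, B i + 1) := div_pos hε hpos
  choose v hv hvw using fun l => exists_isKernelCombo_near hr1 hσ hℓ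
    (w := w l) (by exact_mod_cast hw l) hab hδ
  refine ⟨v, hv, fun i j hj t ht => ?_⟩
  calc _ ≤ B i * (ε / (∑ i, B i + 1)) := abs_iteratedDeriv_matAct_sub_le hPdeg hw
        (fun l => hle hr1 (hv l)) (fun l j hj => (hvw l j hj t ht).le) i hj
    _ < (∑ i, B i + 1) * (ε / (∑ i, B i + 1)) :=
      mul_lt_mul_of_pos_right (by linarith [hBs i]) hδ
    _ = ε := mul_div_cancel₀ _ hpos.ne'
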